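/- arXiv:1408.1064 — 2 statements merged into one kernel-verified Lean document; each statement's English description precedes it below -/
import Mathlib

section
/- Let f, g : ℂ² → ℂ² be ℂ-linear and self-adjoint with respect to B, let v ∈ ℂ², v ≠ 0, and μ ∈ ℝ with f(v) = μ·v and g(v) = μ·v. Suppose there exist real numbers b, c with b² − 4c > 0 such that f∘f + b·f + c·id = 0 and g∘g + b·g + c·id = 0, and suppose f ≠ μ·id and g ≠ μ·id. Then f = g. (A non-scalar self-adjoint endomorphism is uniquely determined by its minimal quadratic polynomial together with the eigenvalue of its restriction to the complex line ℂ·v.) -/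
/-- Eigenvectors for distinct eigenvalues are `B`-orthogonal. -/
lemma orth_aux (B : (Fin 2 → ℂ) →ₗ[ℝ] (Fin 2 → ℂ) →ₗ[ℝ] ℝ)
    (f : (Fin 2 → ℂ) →ₗ[ℂ] (Fin 2 → ℂ))
    (hfsa : ∀ x y : Fin 2 → ℂ, B (f x) y = B x (f y)) (μ ν : ℝ) (hne : μ ≠ ν)
    (u z : Fin 2 → ℂ) (hu : f u = (μ : ℂ) • u) (hz : f z = (ν : ℂ) • z) : B u z = 0 := by
  have h := hfsa u z
  rw [hu, hz, Complex.coe_smul, Complex.coe_smul] at h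
  simp only [map_smul, LinearMap.smul_apply, smul_eq_mul] at h
  have h2 : (μ - ν) * B u z = 0 := by linarith
  exact (mul_eq_zero.mp h2).resolve_left (sub_ne_zero.mpr hne)

/-- The other eigenvector, together with spanning. -/
lemma eig_aux (f : (Fin 2 → ℂ) →ₗ[ℂ] (Fin 2 → ℂ))
    (v : Fin 2 → ℂ) (hv : v ≠ 0) (μ ν b c : ℝ) (hne : μ ≠ ν)
    (hb : b = -(μ + ν)) (hc : c = μ * ν) (hfv : f v = (μ : ℂ) • v)
    (hf2 : f ∘ₗ f + (b : ℂ) • f + (c : ℂ) • (LinearMap.id : (Fin 2 → ℂ) →ₗ[ℂ] (Fin 2 → ℂ)) = 0)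
    (hfne : f ≠ (μ : ℂ) • (LinearMap.id : (Fin 2 → ℂ) →ₗ[ℂ] (Fin 2 → ℂ))) :
    ∃ w : Fin 2 → ℂ, f w = (ν : ℂ) • w ∧ ∀ y, ∃ p q : ℂ, p • v + q • w = y := by
  obtain ⟨x, hx⟩ : ∃ x, f x ≠ (μ : ℂ) • x := by
    by_contra! h
    exact hfne (LinearMap.ext fun x => by simpa using h x)
  have h2 := LinearMap.congr_fun hf2 x
  simp only [LinearMap.add_apply, LinearMap.comp_apply, LinearMap.smul_apply, LinearMap.id_apply,
    LinearMap.zero_apply] at h2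
  have hw : f (f x - (μ : ℂ) • x) = (ν : ℂ) • (f x - (μ : ℂ) • x) := by
    rw [map_sub, map_smul, ← sub_eq_zero, ← h2, hb, hc]
    push_cast
    module
  have hw0 : f x - (μ : ℂ) • x ≠ 0 := sub_ne_zero.mpr hx
  refine ⟨_, hw, ?_⟩
  generalize f x - (μ : ℂ) • x = w at hw hw0
  have hne' : (μ : ℂ) - ν ≠ 0 := by
    rw [sub_ne_zero]; exact_mod_cast hne
  have li : LinearIndependent ℂ ![v, w] := by
    rw [LinearIndependent.pair_iff]
    intro s t hst
    have h3 : f (s • v + t • w) = 0 := by rw [hst, map_zero]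
    rw [map_add, map_smul, map_smul, hfv, hw] at h3
    have h4 : (((μ : ℂ) - ν) * s) • v = 0 := by
      have : (((μ : ℂ) - ν) * s) • v
          = (s • (μ : ℂ) • v + t • (ν : ℂ) • w) - (ν : ℂ) • (s • v + t • w) := by module
      rw [this, h3, hst]; simp
    have hs : s = 0 := by
      rcases smul_eq_zero.mp h4 with h | h
      · exact (mul_eq_zero.mp h).resolve_left hne'
      · exact absurd h hv
    subst hs
    simp only [zero_smul, zero_add] at hst
    exact ⟨rfl, (smul_eq_zero.mp hst).resolve_right hw0⟩
  intro y
  have hs := li.span_eq_top_of_card_eq_finrank' (by simp)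
  have hy : y ∈ Submodule.span ℂ (Set.range ![v, w]) := by rw [hs]; trivial
  rw [Matrix.range_cons, Matrix.range_cons, Matrix.range_empty, Set.union_empty,
    Set.singleton_union] at hy
  exact Submodule.mem_span_pair.mp hy

/-- A non-scalar self-adjoint endomorphism of `(ℂ², B)` is uniquely determined by its
minimal quadratic polynomial together with the eigenvalue of its restriction to the
complex line `ℂ·v`:  if `f, g` are self-adjoint, `f(v) = g(v) = μ·v` with `μ ∈ ℝ`,
both satisfy `X² + bX + c = 0` with `b² − 4c > 0`, and neither is `μ·id`, then `f = g`. -/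
theorem selfAdjoint_determined_by_polynomial_and_eigenvalue
    (B : (Fin 2 → ℂ) →ₗ[ℝ] (Fin 2 → ℂ) →ₗ[ℝ] ℝ)
    (hAlt : ∀ x : Fin 2 → ℂ, B x x = 0)
    (hCompat : ∀ x y : Fin 2 → ℂ, B (Complex.I • x) (Complex.I • y) = B x y)
    (hPos : ∀ x : Fin 2 → ℂ, x ≠ 0 → 0 < B x (Complex.I • x))
    (f g : (Fin 2 → ℂ) →ₗ[ℂ] (Fin 2 → ℂ))
    (hfsa : ∀ x y : Fin 2 → ℂ, B (f x) y = B x (f y))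
    (hgsa : ∀ x y : Fin 2 → ℂ, B (g x) y = B x (g y))
    (v : Fin 2 → ℂ) (hv : v ≠ 0)
    (μ : ℝ) (hfv : f v = (μ : ℂ) • v) (hgv : g v = (μ : ℂ) • v)
    (b c : ℝ) (hbc : b ^ 2 - 4 * c > 0)
    (hf2 : f ∘ₗ f + (b : ℂ) • f + (c : ℂ) • (LinearMap.id : (Fin 2 → ℂ) →ₗ[ℂ] (Fin 2 → ℂ)) = 0)
    (hg2 : g ∘ₗ g + (b : ℂ) • g + (c : ℂ) • (LinearMap.id : (Fin 2 → ℂ) →ₗ[ℂ] (Fin 2 → ℂ)) = 0)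
    (hfne : f ≠ (μ : ℂ) • (LinearMap.id : (Fin 2 → ℂ) →ₗ[ℂ] (Fin 2 → ℂ)))
    (hgne : g ≠ (μ : ℂ) • (LinearMap.id : (Fin 2 → ℂ) →ₗ[ℂ] (Fin 2 → ℂ))) :
    f = g := by
  obtain ⟨ν, hν⟩ : ∃ ν : ℝ, b = -(μ + ν) := ⟨-b - μ, by ring⟩
  have hroot : μ ^ 2 + b * μ + c = 0 := by
    have h2 := LinearMap.congr_fun hf2 v
    simp only [LinearMap.add_apply, LinearMap.comp_apply, LinearMap.smul_apply, LinearMap.id_apply,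
      LinearMap.zero_apply, hfv, map_smul] at h2
    have h3 : ((μ : ℂ) ^ 2 + b * μ + c) • v = 0 := by
      rw [← h2]; module
    have h4 := (smul_eq_zero.mp h3).resolve_right hv
    exact_mod_cast h4
  have hc : c = μ * ν := by subst hν; linarith
  have hne : μ ≠ ν := by
    rintro rfl
    subst hν hc
    linarith [hbc, show (-(μ + μ)) ^ 2 - 4 * (μ * μ) = 0 by ring]
  obtain ⟨w, hw, hws⟩ := eig_aux f v hv μ ν b c hne hν hc hfv hf2 hfne
  obtain ⟨z, hz, hzs⟩ := eig_aux g v hv μ ν b c hne hν hc hgv hg2 hgne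
  obtain ⟨a, t, hat⟩ := hws z
  have h1 : B (a • v) (Complex.I • z) = 0 :=
    orth_aux B g hgsa μ ν hne _ _ (by rw [map_smul, hgv, smul_comm])
      (by rw [map_smul, hz, smul_comm])
  have h2 : B (a • v) (Complex.I • t • w) = 0 :=
    orth_aux B f hfsa μ ν hne _ _ (by rw [map_smul, hfv, smul_comm])
      (by rw [map_smul, map_smul, hw]; module)
  have ha : a • v = 0 := by
    by_contra h
    have h3 := hPos _ h
    rw [← hat, smul_add, map_add, h2] at h1
    linarith
  rw [ha, zero_add] at hat
  have hfz : f z = (ν : ℂ) • z := by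
    rw [← hat, map_smul, hw, smul_comm]
  refine LinearMap.ext fun y => ?_
  obtain ⟨p, q, rfl⟩ := hzs y
  simp only [map_add, map_smul, hfv, hgv, hz, hfz]
end

section
/- Let w, h, e ∈ ℤ with e odd. Then there exists no 4×4 integer matrix g such that gᵀ · M · g = M and T(w,h,e) · g = g · (T(w,h,−e) + e·I₄). In other words, the matrices T(w,h,e) and T(w,h,−e) + e·I₄ are not conjugate by any integral isometry of the skew-symmetric form M. -/
open Matrix

/-- The Gram matrix `M = diag(J, 2J)`. -/
def Mmat : Matrix (Fin 4) (Fin 4) ℤ :=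
  !![0, 1, 0, 0; -1, 0, 0, 0; 0, 0, 0, 2; 0, 0, -2, 0]

/-- The matrix `T(w,h,e) = [[e·I₂, diag(2w,2h)], [diag(h,w), 0]]`. -/
def Tmat (w h e : ℤ) : Matrix (Fin 4) (Fin 4) ℤ :=
  !![e, 0, 2*w, 0; 0, e, 0, 2*h; h, 0, 0, 0; 0, w, 0, 0]

/-- For `e` odd, there is no integral isometry of the skew-symmetric form `M`
conjugating `T(w,h,−e) + e·I₄` to `T(w,h,e)`. -/
theorem not_conjugate_by_integral_isometry (w h e : ℤ) (he : Odd e) :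
    ¬ ∃ g : Matrix (Fin 4) (Fin 4) ℤ,
        gᵀ * Mmat * g = Mmat ∧
        Tmat w h e * g = g * (Tmat w h (-e) + e • (1 : Matrix (Fin 4) (Fin 4) ℤ)) := by
  rintro ⟨g, h1, h2⟩
  have a := congrFun (congrFun h1 0) 1
  have b := congrFun (congrFun h1 2) 3
  have c00 := congrFun (congrFun h2 0) 0
  have c01 := congrFun (congrFun h2 0) 1
  have c10 := congrFun (congrFun h2 1) 0
  have c11 := congrFun (congrFun h2 1) 1
  simp only [Matrix.mul_apply, Matrix.add_apply, Matrix.smul_apply, Matrix.one_apply] at c00 c01 c10 c11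
  simp [Mmat, Tmat, Matrix.mul_apply, Fin.sum_univ_four] at a b c00 c01 c10 c11
  have hA : Odd (g 0 0 * g 1 1 - g 1 0 * g 0 1) :=
    ⟨-(g 2 0 * g 3 1 - g 3 0 * g 2 1), by linear_combination a⟩
  have hB : g 0 2 * g 1 3 - g 1 2 * g 0 3 = 2 * (1 - (g 2 2 * g 3 3 - g 3 2 * g 2 3)) := by
    linear_combination b
  have hE : Odd (e * e * (g 0 0 * g 1 1 - g 1 0 * g 0 1)) := (he.mul he).mul hA
  have h00 : e * g 0 0 = g 0 2 * h - 2 * w * g 2 0 := by linear_combination c00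
  have h01 : e * g 0 1 = g 0 3 * w - 2 * w * g 2 1 := by linear_combination c01
  have h10 : e * g 1 0 = g 1 2 * h - 2 * h * g 3 0 := by linear_combination c10
  have h11 : e * g 1 1 = g 1 3 * w - 2 * h * g 3 1 := by linear_combination c11
  have key : e * e * (g 0 0 * g 1 1 - g 1 0 * g 0 1)
      = 2 * (w * h * (1 - (g 2 2 * g 3 3 - g 3 2 * g 2 3))
        - g 0 2 * h * h * g 3 1 - w * g 2 0 * (g 1 3 * w) + 2 * w * g 2 0 * h * g 3 1
        + g 1 2 * h * w * g 2 1 + h * g 3 0 * (g 0 3 * w) - 2 * h * g 3 0 * w * g 2 1) := by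
    have : e * e * (g 0 0 * g 1 1 - g 1 0 * g 0 1)
      = (e * g 0 0) * (e * g 1 1) - (e * g 1 0) * (e * g 0 1) := by ring
    rw [this, h00, h01, h10, h11]
    linear_combination w * h * hB
  rw [key] at hE
  exact (Int.not_odd_iff_even.mpr (even_two_mul _)) hE
end
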